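/- Let k be a field and let g_0, ..., g_l be a regular sequence of homogeneous elements in k[Y_0,...,Y_n]. Let U = k[X_0, X_1, Y_0, ..., Y_n, W_1, ..., W_l] and let J be the ideal generated by the l+1 elements X_1^{i_1-i_0} W_1 + g_0, X_1^{i_2-i_1} W_2 + g_1 - X_0^{i_1-i_0} W_1, ..., g_l - X_0^{i_l-i_{l-1}} W_l, for a strictly increasing sequence 0 = i_0 < i_1 < ... < i_l = d of integers. Then in the quotient ring R = U/J, the localization R[X_0^{-1}] is isomorphic to (k[X_0,X_1,Y_0,...,Y_n]/(r))[X_0^{-1}], where r = g_0 X_0^d + g_1 X_0^{d-i_1} X_1^{i_1} + ... + g_l X_1^d. -/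

import Mathlib

open MvPolynomial

set_option synthInstance.maxHeartbeats 1000000
set_option maxHeartbeats 1000000

theorem away_equiv_aux {U V : Type*} [CommRing U] [CommRing V] (J : Ideal U) (K : Ideal V)
    (a : U) (b : V)
    (f : U →+* Localization.Away (Ideal.Quotient.mk K b))
    (h : V →+* Localization.Away (Ideal.Quotient.mk J a))
    (hf : ∀ x ∈ J, f x = 0) (hh : ∀ x ∈ K, h x = 0)
    (hfa : f a = algebraMap _ _ (Ideal.Quotient.mk K b))
    (hhb : h b = algebraMap _ _ (Ideal.Quotient.mk J a))
    (h1 : ∀ H : Localization.Away (Ideal.Quotient.mk K b) →+*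
        Localization.Away (Ideal.Quotient.mk J a),
      (∀ v, H (algebraMap _ _ (Ideal.Quotient.mk K v)) = h v) →
      ∀ u, H (f u) = algebraMap _ _ (Ideal.Quotient.mk J u))
    (h2 : ∀ F : Localization.Away (Ideal.Quotient.mk J a) →+*
        Localization.Away (Ideal.Quotient.mk K b),
      (∀ u, F (algebraMap _ _ (Ideal.Quotient.mk J u)) = f u) →
      ∀ v, F (h v) = algebraMap _ _ (Ideal.Quotient.mk K v)) :
    Nonempty (Localization.Away (Ideal.Quotient.mk J a) ≃+*
      Localization.Away (Ideal.Quotient.mk K b)) := by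
  have uf : IsUnit (Ideal.Quotient.lift J f hf (Ideal.Quotient.mk J a)) := by
    rw [Ideal.Quotient.lift_mk, hfa]
    exact IsLocalization.Away.algebraMap_isUnit _
  have uh : IsUnit (Ideal.Quotient.lift K h hh (Ideal.Quotient.mk K b)) := by
    rw [Ideal.Quotient.lift_mk, hhb]
    exact IsLocalization.Away.algebraMap_isUnit _
  let F : Localization.Away (Ideal.Quotient.mk J a) →+*
      Localization.Away (Ideal.Quotient.mk K b) := IsLocalization.Away.lift _ uf
  let H : Localization.Away (Ideal.Quotient.mk K b) →+*
      Localization.Away (Ideal.Quotient.mk J a) := IsLocalization.Away.lift _ uh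
  have hF : ∀ u, F (algebraMap _ _ (Ideal.Quotient.mk J u)) = f u := fun u => by
    simp only [F, IsLocalization.Away.lift_eq, Ideal.Quotient.lift_mk]
  have hH : ∀ v, H (algebraMap _ _ (Ideal.Quotient.mk K v)) = h v := fun u => by
    simp only [H, IsLocalization.Away.lift_eq, Ideal.Quotient.lift_mk]
  refine ⟨RingEquiv.ofRingHom F H ?_ ?_⟩
  · apply IsLocalization.ringHom_ext (Submonoid.powers (Ideal.Quotient.mk K b))
    apply Ideal.Quotient.ringHom_ext
    ext v
    simp only [RingHom.comp_apply, RingHom.id_apply]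
    rw [hH, h2 F hF]
  · apply IsLocalization.ringHom_ext (Submonoid.powers (Ideal.Quotient.mk J a))
    apply Ideal.Quotient.ringHom_ext
    ext v
    simp only [RingHom.comp_apply, RingHom.id_apply]
    rw [hF, h1 H hH]

/-- closed form of the solutions -/
def cf {B : Type*} [CommRing B] (l : ℕ) (i : ℕ → ℕ) (g : ℕ → B) (x1 u : B) (m : ℕ) : B :=
  ∑ j ∈ Finset.Icc m l, g j * x1 ^ (i j - i m) * u ^ (i j - i (m - 1))

theorem i_le_aux {l : ℕ} {i : ℕ → ℕ} (hmono : ∀ m < l, i m < i (m + 1)) {a b : ℕ}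
    (hab : a ≤ b) (hb : b ≤ l) : i a ≤ i b := by
  induction b, hab using Nat.le_induction with
  | base => exact le_rfl
  | succ b hab ih => exact (ih (by omega)).trans (hmono b (by omega)).le

theorem cf_last {B : Type*} [CommRing B] (l : ℕ) (i : ℕ → ℕ) (g : ℕ → B) (x1 u : B) :
    cf l i g x1 u (l + 1) = 0 := by
  simp [cf]

theorem cf_rel {B : Type*} [CommRing B] (l : ℕ) (i : ℕ → ℕ)
    (hmono : ∀ m < l, i m < i (m + 1)) (g : ℕ → B) (x0 x1 u : B)
    (hu : u * x0 = 1) (m : ℕ) (hm : m ≤ l) :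
    x0 ^ (i m - i (m - 1)) * cf l i g x1 u m =
      x1 ^ (i (m + 1) - i m) * cf l i g x1 u (m + 1) + g m := by
  have key : ∀ p q : ℕ, x0 ^ p * u ^ (q + p) = u ^ q := fun p q => by
    rw [pow_add, mul_left_comm, ← mul_pow, mul_comm x0, hu, one_pow, mul_one]
  have hm1 : i (m - 1) ≤ i m := i_le_aux hmono (by omega) hm
  have e1 : x0 ^ (i m - i (m - 1)) * cf l i g x1 u m =
      ∑ j ∈ Finset.Icc m l, g j * x1 ^ (i j - i m) * u ^ (i j - i m) := by
    rw [cf, Finset.mul_sum]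
    refine Finset.sum_congr rfl fun j hj => ?_
    rw [Finset.mem_Icc] at hj
    have := i_le_aux hmono hj.1 hj.2
    rw [show i j - i (m - 1) = (i j - i m) + (i m - i (m - 1)) by omega, mul_left_comm, key]
  rw [e1, ← Finset.add_sum_Ioc_eq_sum_Icc hm, add_comm, cf, Finset.mul_sum]
  congr 1
  · have : Finset.Ioc m l = Finset.Icc (m + 1) l := by
      ext; simp [Finset.mem_Ioc, Finset.mem_Icc]
    rw [this]
    refine Finset.sum_congr rfl fun j hj => ?_
    rw [Finset.mem_Icc] at hj
    have := i_le_aux hmono hj.1 hj.2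
    have := hmono m (by omega)
    rw [show i j - i m = (i (m + 1) - i m) + (i j - i (m + 1)) by omega, pow_add x1]
    rw [show i (m + 1) - i m + (i j - i (m + 1)) = i j - i (m + 1 - 1) by
      rw [Nat.add_sub_cancel]; omega]
    ring
  · simp

theorem cf_zero {B : Type*} [CommRing B] (l : ℕ) (i : ℕ → ℕ) (hi0 : i 0 = 0)
    (hmono : ∀ m < l, i m < i (m + 1)) (g : ℕ → B) (x0 x1 u : B) (hu : u * x0 = 1) :
    x0 ^ (i l) * cf l i g x1 u 0 =
      ∑ m ∈ Finset.range (l + 1), g m * x0 ^ (i l - i m) * x1 ^ (i m) := by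
  rw [cf, Finset.mul_sum]
  refine Finset.sum_congr (by ext; simp) fun j hj => ?_
  rw [Finset.mem_range] at hj
  have := i_le_aux hmono (show j ≤ l by omega) le_rfl
  have h2 : x0 ^ (i l) = x0 ^ (i l - i j) * x0 ^ (i j) := by
    rw [← pow_add]; congr 1; omega
  have h3 : u ^ (i j) * x0 ^ (i j) = 1 := by rw [← mul_pow, hu, one_pow]
  simp only [hi0, Nat.zero_sub, Nat.sub_zero]
  rw [h2]
  linear_combination (g j * x0 ^ (i l - i j) * x1 ^ (i j)) * h3

theorem cf_unique {B : Type*} [CommRing B] (l : ℕ) (i : ℕ → ℕ)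
    (hmono : ∀ m < l, i m < i (m + 1)) (g : ℕ → B) (x0 x1 u : B)
    (hu : u * x0 = 1) (w : ℕ → B) (hw : w (l + 1) = 0)
    (hrel : ∀ m ≤ l, x1 ^ (i (m + 1) - i m) * w (m + 1) + g m -
      x0 ^ (i m - i (m - 1)) * w m = 0) (m : ℕ) (hm : m ≤ l + 1) :
    w m = cf l i g x1 u m := by
  induction hm using Nat.decreasingInduction with
  | self => rw [hw, cf_last]
  | of_succ m hm ih =>
    have h1 := cf_rel l i hmono g x0 x1 u hu m (by omega)
    have h2 := hrel m (by omega)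
    rw [ih, ← h1] at h2
    have h3 : u ^ (i m - i (m - 1)) * x0 ^ (i m - i (m - 1)) = 1 := by
      rw [← mul_pow, hu, one_pow]
    linear_combination (- u ^ (i m - i (m - 1))) * h2 +
      (cf l i g x1 u m - w m) * h3

theorem map_cf {B C : Type*} [CommRing B] [CommRing C] (F : B →+* C) (l : ℕ) (i : ℕ → ℕ)
    (g : ℕ → B) (x1 u : B) (m : ℕ) :
    F (cf l i g x1 u m) = cf l i (fun j => F (g j)) (F x1) (F u) m := by
  simp [cf]

/-- Let `k` be a field, `g_0, …, g_l` a regular sequence of homogeneous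
elements of `k[Y_0, …, Y_n]`, and `0 = i_0 < i_1 < ⋯ < i_l = d`.  Let
`U = k[X₀, X₁, Y_0, …, Y_n, W₁, …, W_l]` and `J` the ideal generated by the `l+1` elements
`X₁^{i_1-i_0} W₁ + g_0`, `X₁^{i_2-i_1} W₂ + g_1 - X₀^{i_1-i_0} W₁`, …,
`g_l - X₀^{i_l-i_{l-1}} W_l` (convention `W_0 = W_{l+1} = 0`).  Then the localization of
`R = U/J` away from `X₀` is isomorphic to
`(k[X₀, X₁, Y_0, …, Y_n]/(r))[X₀^{-1}]` where
`r = Σ_{m=0}^{l} g_m X₀^{d-i_m} X₁^{i_m}`. -/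
theorem stmt_5 (k : Type*) [Field k] (n l d : ℕ) (hn : 1 ≤ n) (hl : 1 ≤ l) (hd : 1 ≤ d)
    (i : ℕ → ℕ) (hi0 : i 0 = 0) (hil : i l = d) (hmono : ∀ m < l, i m < i (m + 1))
    (g : ℕ → MvPolynomial (Fin (n + 1)) k) (e : ℕ → ℕ)
    (hhom : ∀ j ≤ l, g j ∈ homogeneousSubmodule (Fin (n + 1)) k (e j))
    (hreg : RingTheory.Sequence.IsRegular (MvPolynomial (Fin (n + 1)) k)
      ((List.range (l + 1)).map g)) :
    let U := MvPolynomial (Fin 2 ⊕ (Fin (n + 1) ⊕ Fin l)) k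
    let X0 : U := X (Sum.inl 0)
    let X1 : U := X (Sum.inl 1)
    let G : ℕ → U := fun m => rename (fun v => Sum.inr (Sum.inl v)) (g m)
    let W : ℕ → U := fun m =>
      if h : 1 ≤ m ∧ m ≤ l then X (Sum.inr (Sum.inr ⟨m - 1, by omega⟩)) else 0
    let J : Ideal U := Ideal.span
      {p : U | ∃ m ≤ l, p = X1 ^ (i (m + 1) - i m) * W (m + 1) + G m -
        X0 ^ (i m - i (m - 1)) * W m}
    let V := MvPolynomial (Fin 2 ⊕ Fin (n + 1)) k
    let x0 : V := X (Sum.inl 0)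
    let x1 : V := X (Sum.inl 1)
    let r : V := ∑ m ∈ Finset.range (l + 1),
      rename Sum.inr (g m) * x0 ^ (d - i m) * x1 ^ (i m)
    Nonempty
      (Localization.Away (Ideal.Quotient.mk J X0) ≃+*
        Localization.Away (Ideal.Quotient.mk (Ideal.span {r}) x0)) := by
  intro U X0 X1 G W J V x0 x1 r
  have hW0 : W 0 = 0 := by simp [W]
  have hWl : W (l + 1) = 0 := by simp [W]
  have hWs : ∀ j : Fin l, W (j + 1) = X (Sum.inr (Sum.inr j)) := fun j => by
    have : 1 ≤ (j : ℕ) + 1 ∧ (j : ℕ) + 1 ≤ l := ⟨by omega, j.2⟩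
    simp only [W, dif_pos this]
    rfl
  let K : Ideal V := Ideal.span {r}
  let S := Localization.Away (Ideal.Quotient.mk K x0)
  let T := Localization.Away (Ideal.Quotient.mk J X0)
  let iV : V →+* S := (algebraMap _ _).comp (Ideal.Quotient.mk K)
  let iU : U →+* T := (algebraMap _ _).comp (Ideal.Quotient.mk J)
  obtain ⟨u, hu⟩ : ∃ u, u * iV x0 = 1 := by
    have : IsUnit (iV x0) :=
      IsLocalization.Away.algebraMap_isUnit (S := S) (Ideal.Quotient.mk K x0)
    exact this.exists_left_inv
  obtain ⟨t, ht⟩ : ∃ t, t * iU X0 = 1 := by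
    have : IsUnit (iU X0) :=
      IsLocalization.Away.algebraMap_isUnit (S := T) (Ideal.Quotient.mk J X0)
    exact this.exists_left_inv
  let gS : ℕ → S := fun m => iV (rename Sum.inr (g m))
  let c : ℕ → S := cf l i gS (iV x1) u
  let f : U →+* S := eval₂Hom (iV.comp C)
    (Sum.elim (fun a => iV (X (Sum.inl a)))
      (Sum.elim (fun v => iV (X (Sum.inr v))) (fun j => c (j + 1))))
  let ρ : V →+* U := (rename (Sum.map id Sum.inl) : V →ₐ[k] U).toRingHom
  let h : V →+* T := iU.comp ρ
  have hρ0 : ρ x0 = X0 := rename_X _ _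
  have hρ1 : ρ x1 = X1 := rename_X _ _
  have hρg : ∀ m, ρ (rename Sum.inr (g m)) = G m := fun m => rename_rename _ _ _
  have hρC : ∀ a, ρ (C a) = C a := fun a => rename_C _ _
  have hρX : ∀ a, ρ (X a) = X (Sum.map id Sum.inl a) := fun a => rename_X _ _
  have hfρ : ∀ v, f (ρ v) = iV v := by
    intro v
    have : f.comp ρ = iV := by
      apply MvPolynomial.ringHom_ext
      · intro a
        exact (congrArg f (hρC a)).trans (eval₂Hom_C _ _ _)
      · rintro (a | a)
        · exact (congrArg f (hρX _)).trans (eval₂Hom_X' _ _ _)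
        · exact (congrArg f (hρX _)).trans (eval₂Hom_X' _ _ _)
    exact RingHom.congr_fun this v
  have hf0 : f X0 = iV x0 := by rw [← hρ0, hfρ]
  have hf1 : f X1 = iV x1 := by rw [← hρ1, hfρ]
  have hfG : ∀ m, f (G m) = gS m := fun m => by rw [← hρg, hfρ]
  have hfWs : ∀ j : Fin l, f (X (Sum.inr (Sum.inr j))) = c (j + 1) := fun j =>
    eval₂Hom_X' _ _ _
  have hfW : ∀ m, m < l + 1 → f (W (m + 1)) = c (m + 1) := by
    intro m hm
    rcases Nat.lt_or_ge m l with h' | h'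
    · have := hWs ⟨m, h'⟩
      simp only at this
      rw [this, hfWs]
    · obtain rfl : m = l := by omega
      rw [hWl, map_zero]
      exact (cf_last _ _ _ _ _).symm
  have hrS : iV r = 0 := by
    have : Ideal.Quotient.mk K r = 0 :=
      Ideal.Quotient.eq_zero_iff_mem.mpr (Ideal.subset_span rfl)
    simp only [iV, RingHom.comp_apply, this, map_zero]
  have hc0 : c 0 = 0 := by
    have h1 := cf_zero l i hi0 hmono gS (iV x0) (iV x1) u hu
    have h2 : iV r = ∑ m ∈ Finset.range (l + 1),
        gS m * iV x0 ^ (i l - i m) * iV x1 ^ (i m) := by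
      simp only [r, map_sum, map_mul, map_pow, gS, hil]
    rw [← h2, hrS] at h1
    have h3 : u ^ (i l) * iV x0 ^ (i l) = 1 := by rw [← mul_pow, hu, one_pow]
    change cf l i gS (iV x1) u 0 = 0
    linear_combination (u ^ (i l)) * h1 - (cf l i gS (iV x1) u 0) * h3
  have hfW' : ∀ m ≤ l, f (W m) = c m := by
    intro m hm
    rcases m with _ | m
    · rw [hW0, map_zero, hc0]
    · exact hfW m (by omega)
  have hrel : ∀ m ≤ l, iU X1 ^ (i (m + 1) - i m) * iU (W (m + 1)) + iU (G m) -
      iU X0 ^ (i m - i (m - 1)) * iU (W m) = 0 := by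
    intro m hm
    have : Ideal.Quotient.mk J (X1 ^ (i (m + 1) - i m) * W (m + 1) + G m -
        X0 ^ (i m - i (m - 1)) * W m) = 0 :=
      Ideal.Quotient.eq_zero_iff_mem.mpr (Ideal.subset_span ⟨m, hm, rfl⟩)
    have h2 : iU (X1 ^ (i (m + 1) - i m) * W (m + 1) + G m -
        X0 ^ (i m - i (m - 1)) * W m) = 0 := by
      simp only [iU, RingHom.comp_apply, this, map_zero]
    simpa only [map_sub, map_add, map_mul, map_pow] using h2
  have huniq := cf_unique l i hmono (fun m => iU (G m)) (iU X0) (iU X1) t ht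
    (fun m => iU (W m)) (by simp only [hWl, map_zero]) hrel
  refine away_equiv_aux J K X0 x0 f h ?_ ?_ hf0 ?_ ?_ ?_
  · intro x hx
    have : J ≤ RingHom.ker f := by
      refine Ideal.span_le.mpr ?_
      rintro p ⟨m, hm, rfl⟩
      rw [SetLike.mem_coe, RingHom.mem_ker]
      simp only [map_sub, map_add, map_mul, map_pow]
      rw [hf0, hf1, hfG, hfW m (by omega), hfW' m hm]
      exact sub_eq_zero.mpr (cf_rel l i hmono gS (iV x0) (iV x1) u hu m hm).symm
    exact this hx
  · intro x hx
    have : K ≤ RingHom.ker h := by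
      refine Ideal.span_le.mpr ?_
      rintro p rfl
      rw [SetLike.mem_coe, RingHom.mem_ker]
      have h1 := cf_zero l i hi0 hmono (fun m => iU (G m)) (iU X0) (iU X1) t ht
      rw [← huniq 0 (by omega)] at h1
      simp only [hW0, map_zero, mul_zero] at h1
      simp only [r, map_sum, map_mul, map_pow, h, RingHom.comp_apply, hρg, hρ0, hρ1]
      rw [h1, hil]
    exact this hx
  · change iU (ρ x0) = iU X0
    rw [hρ0]
  · intro H hH
    have hH' : ∀ v, H (iV v) = iU (ρ v) := hH
    have hHu : H u = t := by
      have h1 : H u * iU X0 = 1 := by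
        have h2 : H (iV x0) = iU X0 := (hH' x0).trans (congrArg iU hρ0)
        rw [← h2, ← map_mul, hu, map_one]
      linear_combination t * h1 - H u * ht
    have : H.comp f = iU := by
      apply MvPolynomial.ringHom_ext
      · intro a
        have h1 : (C a : U) = ρ (C a) := (hρC a).symm
        rw [RingHom.comp_apply, h1, hfρ, hH']
      · rintro (a | a | j)
        · have h1 : (X (Sum.inl a) : U) = ρ (X (Sum.inl a)) := (hρX (Sum.inl a)).symm
          rw [RingHom.comp_apply, h1, hfρ, hH']
        · have h1 : (X (Sum.inr (Sum.inl a)) : U) = ρ (X (Sum.inr a)) := (hρX (Sum.inr a)).symm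
          rw [RingHom.comp_apply, h1, hfρ, hH']
        · rw [RingHom.comp_apply, hfWs, ← hWs]
          refine Eq.trans ?_ (huniq (j + 1) (by omega)).symm
          change H (cf l i gS (iV x1) u (j + 1)) = _
          rw [map_cf, hHu, hH', hρ1]
          simp only [gS, hH', hρg]
    exact fun v => RingHom.congr_fun this v
  · intro F hF v
    exact (hF (ρ v)).trans (hfρ v)
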